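/- arXiv:1412.2537 — 2 statements merged into one kernel-verified Lean document; each statement's English description precedes it below -/
import Mathlib

section
/- For any simplicial R-module E ∈ Fun(Δ^op, R-mod), the homology of the normalized chain complex C_•(E) is canonically isomorphic to the homology H_•(Δ^op, E) of the category Δ^op with coefficients in E, i.e., to the left derived functors of colimit over Δ^op applied to E. -/
open CategoryTheory Limits AlgebraicTopology

universe v₁ v₂ u₁ u₂

namespace DerivedColim

section Abstract

variable {C : Type u₁} [Category.{v₁} C] [Abelian C] {D : Type u₂} [Category.{v₂} D] [Abelian D]

/-- The opcycles of `F P` in degree `j` are computed by any right exact presentation. -/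
lemma exists_opcyclesIso (F : C ⥤ D) [F.Additive] [PreservesFiniteColimits F]
    (P : ChainComplex C ℕ) (j : ℕ) {X : C} (π : P.X j ⟶ X) (w : P.d (j + 1) j ≫ π = 0)
    (hc : (ShortComplex.mk _ _ w).Exact) [Epi π] :
    ∃ e : ((F.mapHomologicalComplex _).obj P).opcycles j ≅ F.obj X,
      ((F.mapHomologicalComplex _).obj P).pOpcycles j ≫ e.hom = F.map π := by
  have : Epi (ShortComplex.mk _ _ w).g := ‹Epi π›
  have h1 := CokernelCofork.mapIsColimit _ hc.gIsCokernel F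
  have h2 := ((F.mapHomologicalComplex (ComplexShape.down ℕ)).obj P).opcyclesIsCokernel (j + 1) j
    (by simp)
  refine ⟨IsColimit.coconePointUniqueUpToIso h2 h1, ?_⟩
  exact IsColimit.comp_coconePointUniqueUpToIso_hom h2 h1 WalkingParallelPair.one

theorem derived_iso (F : C ⥤ D) [F.Additive] [PreservesFiniteColimits F]
    (T : C ⥤ ChainComplex D ℕ) [T.PreservesZeroMorphisms]
    (hT : ∀ S : ShortComplex C, S.ShortExact → (S.map T).ShortExact)
    (e : T ⋙ HomologicalComplex.homologyFunctor D _ 0 ≅ F) (n : ℕ) :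
    ∀ (P : ChainComplex C ℕ) (_ : ∀ n, P.ExactAt (n + 1))
      (_ : ∀ i n, IsZero ((T.obj (P.X i)).homology (n + 1)))
      (X : C) (π : P.X 0 ⟶ X) (w : P.d 1 0 ≫ π = 0)
      (_ : (ShortComplex.mk _ _ w).Exact) (_ : Epi π),
      Nonempty ((T.obj X).homology n ≅ ((F.mapHomologicalComplex _).obj P).homology n) := by
  induction n with
  | zero =>
    intro P hP hac X π w hc hπ
    obtain ⟨e', -⟩ := exists_opcyclesIso F P 0 π w hc
    exact ⟨e.app X ≪≫ e'.symm ≪≫ (ChainComplex.isoHomologyι₀ _).symm⟩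
  | succ n ih =>
    intro P hP hac X π w hc hπ
    let S : ShortComplex C := ShortComplex.mk (kernel.ι π) π (kernel.condition π)
    have hS : S.ShortExact :=
      { exact := ShortComplex.exact_of_f_is_kernel _ (kernelIsKernel π)
        mono_f := by dsimp [S]; infer_instance
        epi_g := hπ }
    have hTS := hT S hS
    let π' : P.X 1 ⟶ kernel π := kernel.lift π (P.d 1 0) w
    have hπ' : Epi π' := hc.epi_kernelLift
    have w' : P.d 2 1 ≫ π' = 0 := by
      rw [← cancel_mono (kernel.ι π)]; simp [π']
    have hc' : (ShortComplex.mk _ _ w').Exact := by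
      have h0 : (P.sc' 2 1 0).Exact :=
        (P.exactAt_iff' 2 1 0 (by simp) (by simp)).1 (hP 0)
      let φ : ShortComplex.mk _ _ w' ⟶ P.sc' 2 1 0 :=
        { τ₁ := 𝟙 _, τ₂ := 𝟙 _, τ₃ := kernel.ι π
          comm₁₂ := (Category.id_comp (P.d 2 1)).trans (Category.comp_id (P.d 2 1)).symm
          comm₂₃ := (Category.id_comp (P.d 1 0)).trans (kernel.lift_ι π (P.d 1 0) w).symm }
      have : Epi φ.τ₁ := inferInstanceAs (Epi (𝟙 (P.X 2)))
      have : IsIso φ.τ₂ := inferInstanceAs (IsIso (𝟙 (P.X 1)))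
      have : Mono φ.τ₃ := inferInstanceAs (Mono (kernel.ι π))
      exact (ShortComplex.exact_iff_of_epi_of_isIso_of_mono φ).2 h0
    obtain _ | n := n
    · -- degree one
      obtain ⟨a, ha⟩ := exists_opcyclesIso F P 1 π' w' hc'
      let FP := (F.mapHomologicalComplex (ComplexShape.down ℕ)).obj P
      have k1 := FP.homologyIsKernel 1 0 (by simp)
      have hrel : (ComplexShape.down ℕ).Rel 1 0 := by simp
      have := hTS.mono_δ 1 0 hrel (hac 0 0)
      have k2 := (hTS.homology_exact₁ 1 0 hrel).fIsKernel
      let i1 : FP.homology 1 ≅ kernel (FP.fromOpcycles 1 0) :=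
        IsLimit.conePointUniqueUpToIso k1 (limit.isLimit _)
      let i2 : (T.obj X).homology 1 ≅ kernel (HomologicalComplex.homologyMap (T.map S.f) 0) :=
        IsLimit.conePointUniqueUpToIso k2 (limit.isLimit _)
      have hf : FP.fromOpcycles 1 0 = a.hom ≫ F.map (kernel.ι π) := by
        refine (cancel_epi (FP.pOpcycles 1)).1 ?_
        refine (FP.p_fromOpcycles 1 0).trans ?_
        refine Eq.trans ?_ (Category.assoc _ _ _)
        refine Eq.trans ?_ (congrArg (· ≫ F.map (kernel.ι π)) ha.symm)
        refine Eq.trans ?_ (F.map_comp _ _)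
        exact congrArg F.map (kernel.lift_ι π (P.d 1 0) w).symm
      refine ⟨i2 ≪≫ kernel.mapIso _ _ (e.app (kernel π) ≪≫ a.symm) (e.app (P.X 0)) ?_ ≪≫ i1.symm⟩
      refine (e.hom.naturality (kernel.ι π)).trans ?_
      refine Eq.trans ?_ (congrArg (fun t => (e.app (kernel π) ≪≫ a.symm).hom ≫ t) hf.symm)
      simp
    · obtain ⟨i⟩ := ih (ChainComplex.truncate.obj P) (fun m => by
          have := (P.exactAt_iff' (m + 3) (m + 2) (m + 1) (by simp) (by simp)).1 (hP (m + 1))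
          exact ((ChainComplex.truncate.obj P).exactAt_iff' (m + 2) (m + 1) m
            (by simp) (by simp)).2 this) (fun i m => hac (i + 1) m) (kernel π) π' w' hc' hπ'
      let FP := (F.mapHomologicalComplex (ComplexShape.down ℕ)).obj P
      let FP' := (F.mapHomologicalComplex (ComplexShape.down ℕ)).obj (ChainComplex.truncate.obj P)
      let j1 := FP.homologyIsoSc' (n + 3) (n + 2) (n + 1) (by simp) (by simp)
      let j2 := FP'.homologyIsoSc' (n + 2) (n + 1) n (by simp) (by simp)
      exact ⟨hTS.δIso (n + 2) (n + 1) (by simp) (hac 0 _) (hac 0 _) ≪≫ i ≪≫ j2 ≪≫ j1.symm⟩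

end Abstract

section Simplicial

open Opposite Simplicial

/-- The functor `[n] ↦ [0] ⋆ [n] = [n+1]` adding a new bottom element. -/
def addBot : SimplexCategory ⥤ SimplexCategory where
  obj a := SimplexCategory.mk (a.len + 1)
  map {a b} f := SimplexCategory.mkHom
    { toFun := fun i => Fin.cases (motive := fun _ => Fin (b.len + 1 + 1)) 0
        (fun j => (f.toOrderHom j).succ) i
      monotone' := by
        intro i j h
        induction i using Fin.cases with
        | zero => simp
        | succ i =>
          induction j using Fin.cases with
          | zero => simp at h
          | succ j => simpa using f.toOrderHom.monotone (by simpa using h) }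
  map_id a := by
    ext i : 3
    induction i using Fin.cases with
    | zero => rfl
    | succ i => rfl
  map_comp f g := by
    ext i : 3
    induction i using Fin.cases with
    | zero => rfl
    | succ i => rfl

lemma addBot_map_zero {a b : SimplexCategory} (f : a ⟶ b) :
    (addBot.map f).toOrderHom 0 = 0 := rfl

lemma addBot_map_succ {a b : SimplexCategory} (f : a ⟶ b) (i : Fin (a.len + 1)) :
    (addBot.map f).toOrderHom i.succ = (f.toOrderHom i).succ := rfl

/-- The natural inclusion `[n] → [0] ⋆ [n]`. -/
def toAddBot : 𝟭 SimplexCategory ⟶ addBot where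
  app a := SimplexCategory.mkHom ⟨Fin.succ, fun _ _ h => Fin.succ_le_succ_iff.2 h⟩
  naturality a b f := by
    ext i : 3
    rfl

/-- The retraction `[0] ⋆ [n] → [n]`. -/
lemma toAddBot_split (a : SimplexCategory) : toAddBot.app a ≫ (SimplexCategory.σ (0 : Fin (a.len + 1)) : SimplexCategory.mk (a.len + 1) ⟶ a) = 𝟙 a := by
  ext i : 3
  rfl

lemma addBot_map_δ {n : ℕ} (i : Fin (n + 2)) :
    addBot.map (SimplexCategory.δ i) = SimplexCategory.δ i.succ := by
  ext j : 3
  induction j using Fin.cases with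
  | zero => rfl
  | succ j => exact (Fin.succ_succAbove_succ i j).symm

lemma addBot_map_σ {n : ℕ} (i : Fin (n + 1)) :
    addBot.map (SimplexCategory.σ i) = SimplexCategory.σ i.succ := by
  ext j : 3
  induction j using Fin.cases with
  | zero => rfl
  | succ j => exact (Fin.succ_predAbove_succ i j).symm

variable {A : Type u₁} [Category.{v₁} A]

/-- Décalage. -/
abbrev dec (E : SimplicialObject A) : SimplicialObject A := addBot.op ⋙ E

lemma dec_δ (E : SimplicialObject A) {n : ℕ} (i : Fin (n + 2)) : (dec E).δ i = E.δ i.succ :=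
  congrArg (fun t => E.map (Quiver.Hom.op t)) (addBot_map_δ i)

lemma dec_σ (E : SimplicialObject A) {n : ℕ} (i : Fin (n + 1)) : (dec E).σ i = E.σ i.succ :=
  congrArg (fun t => E.map (Quiver.Hom.op t)) (addBot_map_σ i)

/-- The projection from the décalage. -/
abbrev decTo (E : SimplexCategoryᵒᵖ ⥤ A) : addBot.op ⋙ E ⟶ E where
  app a := E.map (toAddBot.app a.unop).op
  naturality a b f := by
    refine (E.map_comp _ _).symm.trans (Eq.trans ?_ (E.map_comp _ _))
    exact congrArg (fun t => E.map (Quiver.Hom.op t)) (toAddBot.naturality f.unop).symm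

instance (E : SimplexCategoryᵒᵖ ⥤ A) (a) : IsSplitEpi ((decTo E).app a) :=
  ⟨⟨⟨E.map (SimplexCategory.σ (0 : Fin (a.unop.len + 1)) :
    SimplexCategory.mk (a.unop.len + 1) ⟶ a.unop).op, by
      refine (E.map_comp _ _).symm.trans ?_
      exact (congrArg (fun t => E.map (Quiver.Hom.op t)) (toAddBot_split a.unop)).trans
        (E.map_id _)⟩⟩⟩

/-- The augmented décalage. -/
def decAug (E : SimplicialObject A) : SimplicialObject.Augmented A :=
  SimplicialObject.augment (dec E) (E _⦋0⦌) (E.δ (1 : Fin 2)) (by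
    intro i g₁ g₂
    refine (E.map_comp _ _).symm.trans (Eq.trans ?_ (E.map_comp _ _))
    congr 1
    refine congrArg Quiver.Hom.op (?_ : SimplexCategory.δ (1 : Fin 2) ≫ addBot.map g₁ =
      SimplexCategory.δ (1 : Fin 2) ≫ addBot.map g₂)
    ext j : 3
    fin_cases j
    rfl)

lemma decAug_hom (E : SimplicialObject A) : (decAug E).hom.app (op ⦋0⦌) = E.δ (1 : Fin 2) :=
  SimplicialObject.augment_hom_zero _ _ _ _

/-- The extra degeneracy. -/
def decExtra (E : SimplicialObject A) : (decAug E).ExtraDegeneracy where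
  s' := E.σ (0 : Fin 1)
  s n := E.σ (0 : Fin (n + 2))
  s'_comp_ε := by
    refine Eq.trans ?_ (E.δ_comp_σ_succ (i := (0 : Fin 1)))
    exact congrArg (fun t => E.σ (0 : Fin 1) ≫ t) (decAug_hom E)
  s₀_comp_δ₁ := by
    refine Eq.trans (congrArg (fun t => E.σ (0 : Fin 2) ≫ t) (dec_δ E 1)) ?_
    refine Eq.trans ?_ (congrArg (fun t => t ≫ E.σ (0 : Fin 1)) (decAug_hom E)).symm
    exact (E.δ_comp_σ_of_gt (n := 0) (i := 1) (j := 0) (by simp))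
  s_comp_δ₀ n := by
    refine Eq.trans (congrArg (fun t => E.σ (0 : Fin (n + 2)) ≫ t) (dec_δ E 0)) ?_
    exact E.δ_comp_σ_succ
  s_comp_δ n i := by
    refine Eq.trans (congrArg (fun t => E.σ (0 : Fin (n + 3)) ≫ t) (dec_δ E i.succ)) ?_
    refine Eq.trans ?_ (congrArg (fun t => t ≫ E.σ (0 : Fin (n + 2))) (dec_δ E i)).symm
    exact (E.δ_comp_σ_of_gt (i := i.succ) (j := 0) (by simp))
  s_comp_σ n i := by
    refine Eq.trans (congrArg (fun t => E.σ (0 : Fin (n + 2)) ≫ t) (dec_σ E i.succ)) ?_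
    refine Eq.trans ?_ (congrArg (fun t => t ≫ E.σ (0 : Fin (n + 3))) (dec_σ E i)).symm
    exact (E.σ_comp_σ (i := 0) (j := i.succ) (by simp)).symm


end Simplicial

section Homology

open Opposite Simplicial

variable {A : Type u₁} [Category.{v₁} A] [Abelian A]

/-- The alternating face map complex functor on the functor category. -/
noncomputable abbrev alt : (SimplexCategoryᵒᵖ ⥤ A) ⥤ ChainComplex A ℕ :=
  alternatingFaceMapComplex A

instance : (alt (A := A)).PreservesZeroMorphisms where
  map_zero X Y := by
    ext n
    rfl

lemma alt_shortExact (S : ShortComplex (SimplexCategoryᵒᵖ ⥤ A)) (hS : S.ShortExact) :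
    (S.map alt).ShortExact := by
  apply HomologicalComplex.shortExact_of_degreewise_shortExact
  intro i
  exact hS.map_of_exact ((evaluation SimplexCategoryᵒᵖ A).obj (op ⦋i⦌))

lemma isZero_homology_dec (E : SimplexCategoryᵒᵖ ⥤ A) (n : ℕ) :
    IsZero ((alt.obj (addBot.op ⋙ E)).homology (n + 1)) := by
  let h := (decExtra E).homotopyEquiv
  refine IsZero.of_iso ?_ (h.toHomologyIso (n + 1))
  exact (HomologicalComplex.exactAt_iff_isZero_homology _ _).1
    (HomologicalComplex.exactAt_single_obj _ _ _ _ (by simp))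

lemma isZero_homology_projective (E : SimplexCategoryᵒᵖ ⥤ A) [Projective E] (n : ℕ) :
    IsZero ((alt.obj E).homology (n + 1)) := by
  have : ∀ a, Epi ((decTo E).app a) := fun a => inferInstance
  have : Epi (decTo E) := NatTrans.epi_of_epi_app _
  let G := alt (A := A) ⋙ HomologicalComplex.homologyFunctor A _ (n + 1)
  have h : G.map (Projective.factorThru (𝟙 E) (decTo E)) ≫ G.map (decTo E) = 𝟙 _ := by
    rw [← G.map_comp, Projective.factorThru_comp, G.map_id]
  rw [IsZero.iff_id_eq_zero]
  refine Eq.trans h.symm ?_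
  have h0 : G.map (decTo E) = 0 := (isZero_homology_dec E n).eq_of_src _ _
  exact (congrArg (fun t => _ ≫ t) h0).trans comp_zero

variable (E : SimplexCategoryᵒᵖ ⥤ A)

lemma δ_pOpcycles : E.map (SimplexCategory.δ (0 : Fin 2)).op ≫ (alt.obj E).pOpcycles 0 =
    E.map (SimplexCategory.δ (1 : Fin 2)).op ≫ (alt.obj E).pOpcycles 0 := by
  have h := (alt.obj E).d_pOpcycles 1 0
  have hd : (alt.obj E).d 1 0 = E.map (SimplexCategory.δ (0 : Fin 2)).op -
      E.map (SimplexCategory.δ (1 : Fin 2)).op := by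
    refine (AlternatingFaceMapComplex.obj_d_eq E 0).trans ?_
    simp [Fin.sum_univ_two, sub_eq_add_neg]
    rfl
  rw [hd] at h
  rw [← sub_eq_zero]
  exact (Preadditive.sub_comp _ _ _).symm.trans h

/-- The map picking out the vertex `i`. -/
abbrev vtx (a : SimplexCategory) (i : Fin (a.len + 1)) : ⦋0⦌ ⟶ a := SimplexCategory.const ⦋0⦌ a i

lemma vtx_pOpcycles (a : SimplexCategory) (i : Fin (a.len + 1)) :
    E.map (vtx a i).op ≫ (alt.obj E).pOpcycles 0 =
      E.map (vtx a 0).op ≫ (alt.obj E).pOpcycles 0 := by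
  let g : ⦋1⦌ ⟶ a := SimplexCategory.mkOfLe 0 i (Fin.zero_le _)
  have h0 : vtx a i = SimplexCategory.δ (0 : Fin 2) ≫ g := by
    ext j : 3
    fin_cases j
    rfl
  have h1 : vtx a 0 = SimplexCategory.δ (1 : Fin 2) ≫ g := by
    ext j : 3
    fin_cases j
    rfl
  rw [h0, h1, op_comp, op_comp, E.map_comp, E.map_comp]
  exact (Category.assoc _ _ _).trans
    ((congrArg (fun t => E.map g.op ≫ t) (δ_pOpcycles E)).trans (Category.assoc _ _ _).symm)

/-- The cocone with vertex the zeroth opcycles. -/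
noncomputable def opcCocone : Cocone E where
  pt := (alt.obj E).opcycles 0
  ι :=
    { app := fun a => E.map (vtx a.unop 0).op ≫ (alt.obj E).pOpcycles 0
      naturality := by
        intro a b f
        have h : vtx b.unop 0 ≫ f.unop = vtx a.unop (f.unop.toOrderHom 0) := by
          ext j : 3
          rfl
        refine Eq.trans ?_ (Category.comp_id _).symm
        refine (Category.assoc _ _ _).symm.trans ?_
        refine Eq.trans ?_ (vtx_pOpcycles E a.unop (f.unop.toOrderHom 0))
        refine congrArg (fun t => t ≫ (alt.obj E).pOpcycles 0) ?_
        refine (E.map_comp _ _).symm.trans ?_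
        exact congrArg (fun t => E.map (Quiver.Hom.op t)) h }

lemma d_cocone (s : Cocone E) : (alt.obj E).d 1 0 ≫ s.ι.app (op ⦋0⦌) = 0 := by
  refine Eq.trans (congrArg (fun t => t ≫ s.ι.app (op ⦋0⦌))
    (AlternatingFaceMapComplex.obj_d_eq E 0)) ?_
  have h0 : E.map (SimplexCategory.δ (0 : Fin 2)).op ≫ s.ι.app (op ⦋0⦌) = s.ι.app (op ⦋1⦌) :=
    s.w _
  have h1 : E.map (SimplexCategory.δ (1 : Fin 2)).op ≫ s.ι.app (op ⦋0⦌) = s.ι.app (op ⦋1⦌) :=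
    s.w _
  have : (∑ i : Fin (0 + 2), (-1 : ℤ) ^ (i : ℕ) • SimplicialObject.δ (n := 0) E i) =
    E.map (SimplexCategory.δ (0 : Fin 2)).op - E.map (SimplexCategory.δ (1 : Fin 2)).op := by
    simp [Fin.sum_univ_two, sub_eq_add_neg]
    rfl
  refine (congrArg (fun t => t ≫ s.ι.app (op ⦋0⦌)) this).trans ?_
  refine (Preadditive.sub_comp _ _ _).trans ?_
  exact sub_eq_zero.2 (h0.trans h1.symm)

/-- It is a colimit. -/
noncomputable def opcIsColimit : IsColimit (opcCocone E) where
  desc s := (alt.obj E).descOpcycles (s.ι.app (op ⦋0⦌)) 1 (by simp) (d_cocone E s)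
  fac s a := by
    refine (Category.assoc _ _ _).trans ?_
    refine (congrArg (fun t => E.map (vtx a.unop 0).op ≫ t)
      ((alt.obj E).p_descOpcycles _ _ _ _)).trans ?_
    exact s.w _
  uniq s m hm := by
    refine (cancel_epi ((alt.obj E).pOpcycles 0)).1 ?_
    refine Eq.trans ?_ ((alt.obj E).p_descOpcycles _ _ _ _).symm
    refine Eq.trans ?_ (hm (op ⦋0⦌))
    refine congrArg (fun t => t ≫ m) ?_
    have : vtx ⦋0⦌ 0 = 𝟙 _ := by
      ext j : 3
      fin_cases j
      rfl
    have h2 : E.map (vtx ⦋0⦌ 0).op = 𝟙 _ := by rw [this]; exact E.map_id _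
    exact ((congrArg (fun t => t ≫ (alt.obj E).pOpcycles 0) h2).trans (Category.id_comp _)).symm

variable [HasColimitsOfShape SimplexCategoryᵒᵖ A]

/-- The zeroth homology is the colimit. -/
noncomputable def colimIso :
    alt (A := A) ⋙ HomologicalComplex.homologyFunctor A _ 0 ≅ colim :=
  NatIso.ofComponents (fun E => (alt.obj E).isoHomologyι₀ ≪≫
      (opcIsColimit E).coconePointUniqueUpToIso (colimit.isColimit E)) (by
    intro X Y f
    have hX : ∀ X : SimplexCategoryᵒᵖ ⥤ A, (alt.obj X).pOpcycles 0 ≫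
        ((opcIsColimit X).coconePointUniqueUpToIso (colimit.isColimit X)).hom =
          colimit.ι X (op ⦋0⦌) := fun X =>
        (alt.obj X).p_descOpcycles _ 1 (by simp) (d_cocone X (colimit.cocone X))
    have key : HomologicalComplex.opcyclesMap (alt.map f) 0 ≫
        ((opcIsColimit Y).coconePointUniqueUpToIso (colimit.isColimit Y)).hom =
        ((opcIsColimit X).coconePointUniqueUpToIso (colimit.isColimit X)).hom ≫ colim.map f := by
      refine (cancel_epi ((alt.obj X).pOpcycles 0)).1 ?_
      refine Eq.trans ?_ ((congrArg (fun t => t ≫ colim.map f) (hX X)).symm.trans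
        (Category.assoc _ _ _))
      refine (Category.assoc _ _ _).symm.trans ?_
      refine (congrArg (fun t => t ≫ _) (HomologicalComplex.p_opcyclesMap (alt.map f) 0)).trans ?_
      refine (Category.assoc _ _ _).trans ?_
      refine (congrArg (fun t => _ ≫ t) (hX Y)).trans ?_
      exact (colimit.ι_map f (op ⦋0⦌)).symm
    have h1 := HomologicalComplex.homologyι_naturality (alt.map f) 0
    have h2 : HomologicalComplex.homologyMap (alt.map f) 0 ≫ (alt.obj Y).homologyι 0 ≫
        ((opcIsColimit Y).coconePointUniqueUpToIso (colimit.isColimit Y)).hom =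
        ((alt.obj X).homologyι 0 ≫
          ((opcIsColimit X).coconePointUniqueUpToIso (colimit.isColimit X)).hom) ≫ colim.map f := by
      refine Eq.trans ?_ (Category.assoc _ _ _).symm
      refine Eq.trans ?_ (congrArg (fun t => (alt.obj X).homologyι 0 ≫ t) key)
      refine (Category.assoc _ _ _).symm.trans ?_
      refine Eq.trans ?_ (Category.assoc _ _ _)
      exact congrArg (fun t => t ≫
        ((opcIsColimit Y).coconePointUniqueUpToIso (colimit.isColimit Y)).hom) h1
    exact h2)

end Homology

end DerivedColim

/-- for any simplicial `R`-module `E`, the homology of the normalized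
(Moore) chain complex `C_•(E)` is canonically isomorphic to the homology
`H_•(Δᵒᵖ, E)` of the category `Δᵒᵖ` with coefficients in `E`, i.e. to the left derived
functors of the colimit over `Δᵒᵖ` applied to `E`. -/
theorem normalized_chain_homology_is_derived_colimit
    (R : Type) [Ring R]
    [(colim (J := SimplexCategoryᵒᵖ) (C := ModuleCat.{0} R)).Additive]
    [EnoughProjectives (SimplexCategoryᵒᵖ ⥤ ModuleCat.{0} R)]
    (E : SimplicialObject (ModuleCat.{0} R)) (n : ℕ) :
    Nonempty ((((normalizedMooreComplex (ModuleCat R)).obj E).homology n)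
      ≅ ((colim (J := SimplexCategoryᵒᵖ) (C := ModuleCat.{0} R)).leftDerived n).obj E) := by
  let E' : SimplexCategoryᵒᵖ ⥤ ModuleCat.{0} R := E
  let P : ProjectiveResolution E' := ProjectiveResolution.of E'
  obtain ⟨i⟩ := DerivedColim.derived_iso (colim (J := SimplexCategoryᵒᵖ) (C := ModuleCat.{0} R))
    DerivedColim.alt DerivedColim.alt_shortExact DerivedColim.colimIso n P.complex
    P.complex_exactAt_succ (fun i m => DerivedColim.isZero_homology_projective _ m)
    E' (P.π.f 0) P.complex_d_comp_π_f_zero P.exact₀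
    (epi_of_isColimit_cofork P.isColimitCokernelCofork)
  let j := (DoldKan.homotopyEquivNormalizedMooreComplexAlternatingFaceMapComplex
    (Y := E)).toHomologyIso n
  exact ⟨j ≪≫ i ≪≫ (P.isoLeftDerivedObj _ n).symm⟩
end

section
/- For any small category C and ring R, the homology of C with constant coefficients R is naturally isomorphic to the simplicial homology of the nerve: H_•(C, R) ≅ H_•(N(C), R). -/
open CategoryTheory Limits AlgebraicTopology

namespace NerveHom
open Opposite Simplicial MonoidalCategory

variable {C : Type} [SmallCategory C]

/-- Chains in `C` with a compatible cocone with vertex `c`. -/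
structure Tt (C : Type) [SmallCategory C] (n : ℕ) (c : C) : Type where
  F : Fin (n + 1) ⥤ C
  i : F ⟶ (Functor.const _).obj c

/-- functor to the simplices -/
def sC (C : Type) [SmallCategory C] : SimplexCategoryᵒᵖ ⥤ C ⥤ Type where
  obj D :=
    { obj c := Tt C D.unop.len c
      map f := ↾fun x ↦ ⟨x.F, x.i ≫ (Functor.const _).map f⟩
      map_id c := by ext x; cases x; simp
      map_comp f g := by ext x; cases x; simp }
  map f :=
    { app c := ↾fun x ↦ ⟨(SimplexCategory.toCat.map f.unop).toFunctor ⋙ x.F,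
        Functor.whiskerLeft (SimplexCategory.toCat.map f.unop).toFunctor x.i⟩
      naturality c d g := rfl }
  map_id D := rfl
  map_comp f g := rfl

/-- simplicial set over `c` -/
abbrev S (c : C) : SSet.{0} := (sC C).flip.obj c

/-- the transformation to the terminal object -/
def toTerm (c : C) : 𝟭 (Over c) ⟶ (Functor.const _).obj (Over.mk (𝟙 c)) where
  app X := Over.homMk X.hom
  naturality X Y f := by ext; simp

/-- homotopy functor -/
def HF (c : C) : Over c × Fin 2 ⥤ Over c :=
  CategoryTheory.Prod.swap _ _ ⋙ Functor.uncurry.obj (ComposableArrows.mk₁ (toTerm c))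

/-- back from functors to Over -/
def ofOver (c : C) {n : ℕ} (G : Fin (n+1) ⥤ Over c) : Tt C n c :=
  ⟨G ⋙ Over.forget c, Functor.whiskerLeft G (Over.forgetCocone c).ι⟩

/-- functor from a simplex of the interval -/
def uF {D : SimplexCategoryᵒᵖ} (u : (Δ[1] : SSet.{0}).obj D) : Fin (D.unop.len + 1) ⥤ Fin 2 :=
  (SimplexCategory.toCat.map (SSet.stdSimplex.objEquiv u)).toFunctor

/-- homotopy -/
def hh (c : C) : S c ⊗ Δ[1] ⟶ S c where
  app _ := ↾fun x ↦ ofOver c ((Over.lift x.1.F x.1.i).prod' (uF x.2) ⋙ HF c)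
  naturality _ _ _ := rfl

/-- constant map -/
def cst (c : C) : S c ⟶ S c where
  app _ := ↾fun _ ↦ ⟨(Functor.const _).obj c, 𝟙 _⟩
  naturality _ _ _ := rfl

lemma Tt_ext {n : ℕ} {c : C} {x y : Tt C n c} (h : x.F = y.F) (h' : HEq x.i y.i) : x = y := by
  cases x; cases y; cases h; cases h'; rfl

lemma Tt_ext' {n : ℕ} {c : C} {x y : Tt C n c} (h : ∀ i, x.F.obj i = y.F.obj i)
    (hm : ∀ i j (f : i ⟶ j), HEq (x.F.map f) (y.F.map f))
    (h' : ∀ i, HEq (x.i.app i) (y.i.app i)) : x = y := by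
  obtain ⟨F, i⟩ := x
  obtain ⟨G, j⟩ := y
  obtain rfl : F = G := Functor.hext h (fun _ _ f => hm _ _ f)
  congr 1
  ext k
  exact eq_of_heq (h' k)

/-- homotopy from identity to constant -/
noncomputable def hS (c : C) : SSet.Homotopy (𝟙 (S c)) (cst c) :=
  SSet.RelativeMorphism.Homotopy.mk (hh c)
    (by
      ext D x
      refine Tt_ext' (fun _ => rfl) (fun i j f => heq_of_eq ?_) (fun i => HEq.rfl)
      · change 𝟙 _ ≫ x.F.map f = x.F.map f
        simp)
    (by
      ext D x
      refine Tt_ext' (fun _ => rfl) (fun i j f => heq_of_eq ?_) (fun i => HEq.rfl)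
      · change 𝟙 _ ≫ 𝟙 _ = 𝟙 c
        simp)
    (by
      ext D x
      exact x.1.2.elim)

/-! Modules -/
variable (R : Type) [Ring R]

lemma desc_map {A B : Type} (f : A ⟶ B) (M : ModuleCat.{0} R) {x : M} :
    (ModuleCat.free R).map f ≫ ModuleCat.freeDesc (M := M) (↾fun _ ↦ x) =
      ModuleCat.freeDesc (M := M) (↾fun _ ↦ x) ≫ 𝟙 M := by
  apply ModuleCat.free_hom_ext
  intro x
  simp

/-- the map from `R` given by a basis element -/
noncomputable def secf {A : Type} (a : A) : ModuleCat.of R R ⟶ (ModuleCat.free R).obj A :=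
  ModuleCat.ofHom (LinearMap.toSpanSingleton R ((ModuleCat.free R).obj A) (ModuleCat.freeMk a))

lemma secf_one {A : Type} (a : A) : (secf R a).hom (1 : R) = ModuleCat.freeMk a :=
  one_smul R _

lemma desc_mk {A : Type} (a : A) :
    (ModuleCat.freeDesc (M := ModuleCat.of R R) (↾fun (_ : A) ↦ (1 : R))).hom
      (ModuleCat.freeMk a) = (1 : R) :=
  ModuleCat.freeDesc_apply _ _

lemma secf_map {A B : Type} (a : A) (f : A ⟶ B) : secf R a ≫ (ModuleCat.free R).map f =
    secf R (f a) := by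
  ext
  refine (congrArg ((ModuleCat.free R).map f).hom (secf_one R a)).trans ?_
  exact (ModuleCat.free_map_apply (R := R) f a).trans (secf_one R (f a)).symm

lemma secf_desc {A : Type} (a : A) :
    secf R a ≫ ModuleCat.freeDesc (M := ModuleCat.of R R) (↾fun _ ↦ (1 : R)) = 𝟙 _ := by
  ext
  refine (congrArg (ModuleCat.freeDesc (M := ModuleCat.of R R) (↾fun (_ : A) ↦ (1 : R))).hom
    (secf_one R a)).trans ?_
  exact desc_mk R a

lemma desc_secf {A B : Type} (b : B) :
    ModuleCat.freeDesc (X := A) (M := ModuleCat.of R R) (↾fun _ ↦ (1 : R)) ≫ secf R b =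
      (ModuleCat.free R).map (↾fun _ ↦ b) := by
  apply ModuleCat.free_hom_ext
  intro x
  rw [ModuleCat.free_map_apply]
  refine Eq.trans ?_ (secf_one R b)
  exact congrArg (secf R b).hom (desc_mk R x)

/-- simplicial object of functors -/
noncomputable def X (C : Type) [SmallCategory C] : SimplicialObject (C ⥤ ModuleCat.{0} R) :=
  sC C ⋙ (Functor.whiskeringRight _ _ _).obj (ModuleCat.free R)

/-- augmentation -/
noncomputable def AX (C : Type) [SmallCategory C] :
    SimplicialObject.Augmented (C ⥤ ModuleCat.{0} R) where
  left := X R C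
  right := (Functor.const C).obj (ModuleCat.of R R)
  hom :=
    { app D :=
        { app c := ModuleCat.freeDesc (↾fun _ ↦ (1 : R))
          naturality c d f := by
            exact desc_map R _ _ }
      naturality D E f := by
        ext c : 2
        exact desc_map R _ _ }

/-- augmentation at c -/
noncomputable def AXc (c : C) : SimplicialObject.Augmented (ModuleCat.{0} R) :=
  ((SimplicialObject.Augmented.whiskering _ _).obj ((evaluation C (ModuleCat.{0} R)).obj c)).obj (AX R C)

/-- constant augmented object -/
noncomputable def AK : SimplicialObject.Augmented (ModuleCat.{0} R) where
  left := (SimplicialObject.const _).obj (ModuleCat.of R R)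
  right := ModuleCat.of R R
  hom := 𝟙 _

/-- section at c -/
noncomputable def sec (c : C) : (AK R).left ⟶ (AXc R c).left where
  app D := secf R (A := Tt C D.unop.len c) ⟨(Functor.const _).obj c, 𝟙 _⟩
  naturality D E f := by
    change 𝟙 _ ≫ secf R _ = secf R _ ≫ (ModuleCat.free R).map (((sC C).map f).app c)
    rw [Category.id_comp]
    exact (secf_map R (A := Tt C D.unop.len c) (B := Tt C E.unop.len c)
      ⟨(Functor.const _).obj c, 𝟙 _⟩ (((sC C).map f).app c)).symm

/-- extra degeneracy -/
noncomputable def edK : (AK R).ExtraDegeneracy where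
  s' := 𝟙 _
  s n := 𝟙 _
  s'_comp_ε := by simp [AK]
  s₀_comp_δ₁ := by simp [AK, SimplicialObject.δ]
  s_comp_δ₀ := by simp [AK, SimplicialObject.δ]
  s_comp_δ := by simp [AK, SimplicialObject.δ]
  s_comp_σ := by simp [AK, SimplicialObject.σ]

/-- map to the constant object -/
noncomputable def toK (c : C) : AXc R c ⟶ AK R where
  left := (AXc R c).hom
  right := 𝟙 _
  w := by rfl

/-- homotopy equivalence -/
noncomputable def heq1 (c : C) : HomotopyEquiv ((alternatingFaceMapComplex _).obj (AXc R c).left)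
    ((alternatingFaceMapComplex _).obj (AK R).left) where
  hom := (alternatingFaceMapComplex _).map (toK R c).left
  inv := (alternatingFaceMapComplex _).map (sec R c)
  homotopyHomInvId := (Homotopy.ofEq (by
    rw [← Functor.map_comp]
    congr 1
    refine NatTrans.ext (funext fun D => ?_)
    exact desc_secf R _)).trans
    ((hS c).toSimplicialObjectHomotopy.whiskerRight (ModuleCat.free R)).toChainHomotopy.symm |>.trans
    (Homotopy.ofEq (by simp; rfl))
  homotopyInvHomId := Homotopy.ofEq (by
    rw [← Functor.map_comp, ← CategoryTheory.Functor.map_id]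
    congr 1
    refine NatTrans.ext (funext fun D => ?_)
    exact secf_desc R _)

lemma qcomp {K L M : ChainComplex (ModuleCat.{0} R) ℕ} {f : K ⟶ L} {g : L ⟶ M}
    (_ : QuasiIso f) (_ : QuasiIso g) : QuasiIso (f ≫ g) := inferInstance

lemma qright {K L M : ChainComplex (ModuleCat.{0} R) ℕ} {f : K ⟶ L} {g : L ⟶ M}
    (_ : QuasiIso g) (_ : QuasiIso (f ≫ g)) : QuasiIso f :=
  (quasiIso_iff_comp_right f g).1 inferInstance

lemma qiso {K L : ChainComplex (ModuleCat.{0} R) ℕ} {f : K ⟶ L} 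
    (_ : IsIso f)  : QuasiIso f := inferInstance

lemma qi1 (c : C) : QuasiIso (AlternatingFaceMapComplex.ε.app (AXc R c)) := by
  have h := AlternatingFaceMapComplex.ε.naturality (toK R c)
  have h1 : QuasiIso ((alternatingFaceMapComplex _).map (toK R c).left) :=
    (heq1 R c).quasiIso_hom
  have h2 : QuasiIso (AlternatingFaceMapComplex.ε.app (AK R)) := (edK R).homotopyEquiv.quasiIso_hom
  have h3 : (SimplicialObject.Augmented.point ⋙ ChainComplex.single₀ (ModuleCat R)).map (toK R c) =
    𝟙 _ := (ChainComplex.single₀ (ModuleCat R)).map_id _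
  have h4 : AlternatingFaceMapComplex.ε.app (AXc R c) = 
      ((alternatingFaceMapComplex _).map (toK R c).left) ≫ AlternatingFaceMapComplex.ε.app (AK R) := by
    rw [h3] at h
    exact (Category.comp_id _).symm.trans h.symm
  rw [h4]
  exact qcomp R h1 h2

/-- comparison iso -/
noncomputable def cmpIso {A B : Type*} [Category* A] [Category* B] [Preadditive A] [Preadditive B]
    (F : A ⥤ B) [F.Additive] (Y : SimplicialObject A) :
    (F.mapHomologicalComplex _).obj ((alternatingFaceMapComplex A).obj Y) ≅
      (alternatingFaceMapComplex B).obj (((SimplicialObject.whiskering A B).obj F).obj Y) :=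
  (eqToIso (map_alternatingFaceMapComplex F)).app Y

lemma cmpIso_f {A B : Type*} [Category* A] [Category* B] [Preadditive A] [Preadditive B]
    (F : A ⥤ B) [F.Additive] (Y : SimplicialObject A) (n : ℕ) :
    (cmpIso F Y).hom.f n = 𝟙 _ := by
  simp [cmpIso]
  rfl

lemma map_aux {A B : Type*} [Category* A] [Category* B] (F : A ⥤ B) {a b : A} (h : a ⟶ b) :
    F.map h ≫ F.map (𝟙 b) ≫ 𝟙 (F.obj b) = F.map h ≫ 𝟙 (F.obj b) := by
  simp

lemma eps_map {A B : Type*} [Category* A] [Category* B] [Preadditive A] [Preadditive B]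
    [HasZeroObject A] [HasZeroObject B]
    (F : A ⥤ B) [F.Additive] (Y : SimplicialObject.Augmented A) :
    (F.mapHomologicalComplex _).map (AlternatingFaceMapComplex.ε.app Y) ≫
      ((HomologicalComplex.singleMapHomologicalComplex F (ComplexShape.down ℕ) 0).hom.app Y.right) =
    (cmpIso F Y.left).hom ≫ (show _ ⟶ (ChainComplex.single₀ B).obj (F.obj Y.right) from
      AlternatingFaceMapComplex.ε.app
      (((SimplicialObject.Augmented.whiskering _ _).obj F).obj Y)) := by
  apply HomologicalComplex.to_single_hom_ext
  change F.map ((AlternatingFaceMapComplex.ε.app Y).f 0) ≫ 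
    ((HomologicalComplex.singleMapHomologicalComplex F (ComplexShape.down ℕ) 0).hom.app Y.right).f 0
      = (cmpIso F Y.left).hom.f 0 ≫ (AlternatingFaceMapComplex.ε.app
      (((SimplicialObject.Augmented.whiskering _ _).obj F).obj Y)).f 0
  rw [cmpIso_f]
  refine Eq.trans ?_ (Category.id_comp _).symm
  rw [AlternatingFaceMapComplex.ε_app_f_zero, AlternatingFaceMapComplex.ε_app_f_zero,
      HomologicalComplex.singleMapHomologicalComplex_hom_app_self]
  trans F.map (Y.hom.app (op ⦋0⦌)) ≫ F.map (𝟙 _) ≫ 𝟙 _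
  · rfl
  · exact map_aux F (Y.hom.app (op ⦋0⦌))

lemma qi2 : QuasiIso (AlternatingFaceMapComplex.ε.app (AX R C)) := by
  rw [HomologicalComplex.quasiIso_iff_evaluation]
  intro c
  have h := eps_map ((evaluation C (ModuleCat R)).obj c) (AX R C)
  refine qright R (g := (HomologicalComplex.singleMapHomologicalComplex
    ((evaluation C (ModuleCat R)).obj c) (ComplexShape.down ℕ) 0).hom.app (AX R C).right)
    (qiso R inferInstance) ?_
  rw [h]
  exact qcomp R (qiso R inferInstance) (qi1 R c)

/-! projectivity -/

/-- canonical element -/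
def can {n : ℕ} (F : Fin (n + 1) ⥤ C) : Tt C n (F.obj (Fin.last n)) where
  F := F
  i := 
    { app j := F.map (homOfLE (Fin.le_last j))
      naturality i j f := by
        exact (F.map_comp _ _).symm.trans (Category.comp_id _).symm }

lemma can_map (D : SimplexCategoryᵒᵖ) (c : C) (x : Tt C D.unop.len c) :
    ((sC C).obj D).map (x.i.app (Fin.last _)) (can x.F) = x := by
  refine Tt_ext' (fun _ => rfl) (fun _ _ _ => HEq.rfl) (fun i => heq_of_eq ?_)
  exact (x.i.naturality (homOfLE (Fin.le_last i))).trans (Category.comp_id _)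

instance proj (D : SimplexCategoryᵒᵖ) : Projective ((X R C).obj D) where
  factors {E Y} f e he := by
    have hs : ∀ c, Function.Surjective (e.app c) := fun c =>
      (ModuleCat.epi_iff_surjective _).1 inferInstance
    choose g hg using fun (F : Fin (D.unop.len + 1) ⥤ C) => 
      hs (F.obj (Fin.last _)) (f.app _ (ModuleCat.freeMk (can F)))
    refine ⟨
      { app c := ModuleCat.freeDesc (↾fun (x : Tt C D.unop.len c) => 
          E.map (x.i.app (Fin.last _)) (g x.F))
        naturality c d u := ?_ }, ?_⟩
    · apply ModuleCat.free_hom_ext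
      intro x
      refine (congrArg (ConcreteCategory.hom (ModuleCat.freeDesc (M := E.obj d)
        (↾fun (y : Tt C D.unop.len d) => E.map (y.i.app (Fin.last _)) (g y.F))))
        (ModuleCat.free_map_apply (R := R) (((sC C).obj D).map u) x)).trans ?_
      refine (ModuleCat.freeDesc_apply (R := R) _ _).trans ?_
      refine Eq.trans ?_ (congrArg (E.map u) (ModuleCat.freeDesc_apply (R := R) _ x)).symm
      exact ConcreteCategory.congr_hom (E.map_comp (x.i.app (Fin.last _)) u) (g x.F)
    · refine NatTrans.ext (funext fun c => ?_)
      apply ModuleCat.free_hom_ext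
      intro x
      refine (congrArg (e.app c) (ModuleCat.freeDesc_apply (R := R) _ x)).trans ?_
      refine (ConcreteCategory.congr_hom (e.naturality (x.i.app (Fin.last _))) (g x.F)).trans ?_
      refine (congrArg (Y.map (x.i.app (Fin.last _))) (hg x.F)).trans ?_
      refine (ConcreteCategory.congr_hom (f.naturality (x.i.app (Fin.last _)))
        (ModuleCat.freeMk (can x.F))).symm.trans ?_
      refine congrArg (f.app c) ?_
      refine (ModuleCat.free_map_apply (R := R) _ _).trans ?_
      exact congrArg ModuleCat.freeMk (can_map D c x)

/-- cocone -/
def cc (D : SimplexCategoryᵒᵖ) : Cocone ((sC C).obj D) where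
  pt := (nerve C).obj D
  ι := { app c := ↾fun x ↦ x.F
         naturality c d f := rfl }

/-- colimit -/
noncomputable def ccIs (D : SimplexCategoryᵒᵖ) : IsColimit (cc (C := C) D) where
  desc s := ↾fun (F : Fin (D.unop.len + 1) ⥤ C) ↦ s.ι.app _ (can F)
  fac s c := by
    ext x
    have := ConcreteCategory.congr_hom (s.w (x.i.app (Fin.last _))) (can x.F)
    rw [← can_map D c x]
    exact this.symm
  uniq s m h := by
    ext F
    exact ConcreteCategory.congr_hom (h _) (can F)

/-- module version of the cocone is colimit -/
noncomputable def ccR (D : SimplexCategoryᵒᵖ) :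
    IsColimit ((ModuleCat.free R).mapCocone (cc (C := C) D)) :=
  have := (ModuleCat.adj R).leftAdjoint_preservesColimits
  isColimitOfPreserves (ModuleCat.free R) (ccIs D)

/-- the colimit of the resolution -/
noncomputable def colimIso : ((SimplicialObject.whiskering _ _).obj
    (colim (J := C) (C := ModuleCat.{0} R))).obj (X R C) ≅ nerve C ⋙ ModuleCat.free R :=
  NatIso.ofComponents (fun D => (colimit.isColimit ((X R C).obj D)).coconePointUniqueUpToIso
    (ccR R D)) (by
    intro D E f
    apply colimit.hom_ext
    intro c
    have h1 := colimit.comp_coconePointUniqueUpToIso_hom (F := (X R C).obj D) (ccR R D) c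
    have h2 := colimit.comp_coconePointUniqueUpToIso_hom (F := (X R C).obj E) (ccR R E) c
    have h3 := colimit.ι_map ((X R C).map f) c
    refine (Category.assoc _ _ _).symm.trans ?_
    refine (congrArg (· ≫ ((colimit.isColimit ((X R C).obj E)).coconePointUniqueUpToIso
      (ccR R E)).hom) h3).trans ?_
    refine (Category.assoc _ _ _).trans ?_
    refine (congrArg (((X R C).map f).app c ≫ ·) h2).trans ?_
    refine Eq.trans ?_ (Category.assoc _ _ _)
    refine Eq.trans ?_ (congrArg (· ≫ (nerve C ⋙ ModuleCat.free R).map f) h1).symm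
    refine ((ModuleCat.free R).map_comp (((sC C).map f).app c) ((cc E).ι.app c)).symm.trans ?_
    exact (ModuleCat.free R).map_comp ((cc D).ι.app c) ((nerve C).map f))

/-- resolution -/
noncomputable def res : ProjectiveResolution ((Functor.const C).obj (ModuleCat.of R R)) where
  complex := (alternatingFaceMapComplex _).obj (X R C)
  projective n := proj R (op ⦋n⦌)
  π := AlternatingFaceMapComplex.ε.app (AX R C)
  quasiIso := qi2 R

end NerveHom

/-- for any small category `C` and ring `R`, the homology of `C` with
constant coefficients `R` (the derived functors of the colimit applied to the constant
functor `R`) is naturally isomorphic to the simplicial homology of the nerve `N(C)`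
with coefficients in `R` (the homology of the normalized chain complex of `R[N(C)]`). -/
theorem category_homology_is_nerve_homology
    {C : Type} [SmallCategory C] (R : Type) [Ring R]
    [(colim (J := C) (C := ModuleCat.{0} R)).Additive]
    [EnoughProjectives (C ⥤ ModuleCat.{0} R)]
    (n : ℕ) :
    Nonempty
      ((((colim (J := C) (C := ModuleCat.{0} R)).leftDerived n).obj
          ((Functor.const C).obj (ModuleCat.of R R)))
        ≅ (((normalizedMooreComplex (ModuleCat R)).obj
            (nerve C ⋙ ModuleCat.free R)).homology n)) := by
  refine ⟨(NerveHom.res R).isoLeftDerivedObj _ n ≪≫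
    (HomologicalComplex.homologyFunctor _ _ n).mapIso (NerveHom.cmpIso _ _ ≪≫
      (alternatingFaceMapComplex _).mapIso (NerveHom.colimIso R)) ≪≫ 
    (DoldKan.homotopyEquivNormalizedMooreComplexAlternatingFaceMapComplex.toHomologyIso n).symm⟩
end
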